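/- Let α > −1 and β > −1 be real numbers and i ≥ 0 an integer. Then for all real x, Σ_{j=0}^{i} [(α+β+2j+5)/((α+β+j+5)_{i+1})] [(α+β+4)_{j+1} (α+β+4)_j / ((j+1)! j!)] P_{i−j}^{(−α−i−3,−β−i−3)}(x) P_j^{(α+2,β+2)}(x) = (α+β+4) (−1)^i Σ_{ℓ=0}^{i} [(α+3)_{i−ℓ} (−α−β−3)_{i−ℓ} / ((i−ℓ+1)! (i−ℓ)! ℓ! (i−ℓ)!)] [Σ_{m=0}^{ℓ} ((−ℓ)_m (α+β+5)_m (α+β+4)_m (α+i−ℓ+3)_m) / ((α+3)_m (i−ℓ+2)_m (i−ℓ+1)_m m!)] ((x−1)/2)^{ℓ}. -/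

import Mathlib

/-- The Pochhammer symbol (rising factorial) `(a)_k = a (a+1) ⋯ (a+k-1)`. -/
noncomputable def poch (a : ℝ) (k : ℕ) : ℝ := (ascPochhammer ℝ k).eval a

/-- The Jacobi polynomial
`P_n^{(α,β)}(x) = Σ_{k=0}^{n} [(n+α+β+1)_k / k!] [(α+k+1)_{n−k} / (n−k)!] ((x−1)/2)^k`,
valid for all real `α`, `β`. -/
noncomputable def jacobiP (α β : ℝ) (n : ℕ) (x : ℝ) : ℝ :=
  ∑ k ∈ Finset.range (n + 1),
    poch ((n : ℝ) + α + β + 1) k / Nat.factorial k *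
      (poch (α + k + 1) (n - k) / Nat.factorial (n - k)) * ((x - 1) / 2) ^ k

lemma poch_zero (a : ℝ) : poch a 0 = 1 := by simp [poch]

lemma poch_succ (a : ℝ) (k : ℕ) : poch a (k + 1) = poch a k * (a + k) :=
  ascPochhammer_succ_eval k a

lemma poch_add (a : ℝ) (m n : ℕ) : poch a (m + n) = poch a m * poch (a + m) n := by
  induction n with
  | zero => simp [poch_zero]
  | succ n ih =>
    rw [← add_assoc, poch_succ, ih, poch_succ]
    push_cast
    ring

lemma poch_succ' (a : ℝ) (k : ℕ) : poch a (k + 1) = a * poch (a + 1) k := by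
  rw [add_comm k 1, poch_add, poch_succ, poch_zero]
  simp

lemma poch_pos {a : ℝ} (ha : 0 < a) (k : ℕ) : 0 < poch a k :=
  ascPochhammer_pos k a ha

lemma factorial_mul_poch (n k : ℕ) :
    (n.factorial : ℝ) * poch ((n : ℝ) + 1) k = (n + k).factorial := by
  induction k with
  | zero => simp [poch_zero]
  | succ k ih =>
    rw [poch_succ, ← mul_assoc, ih, ← add_assoc, Nat.factorial_succ]
    push_cast
    ring

lemma poch_neg (y : ℝ) (n : ℕ) : poch (1 - y - n) n = (-1) ^ n * poch y n := by
  induction n with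
  | zero => simp [poch_zero]
  | succ n ih =>
    rw [poch_succ', poch_succ, pow_succ]
    have h : 1 - y - ((n + 1 : ℕ) : ℝ) + 1 = 1 - y - n := by push_cast; ring
    rw [h, ih]
    push_cast
    ring

lemma factorial_mul_poch_neg (s m : ℕ) :
    (s.factorial : ℝ) * poch (-((s + m : ℕ) : ℝ)) m = (-1) ^ m * (s + m).factorial := by
  rw [← factorial_mul_poch, mul_left_comm, ← poch_neg]
  congr 2
  push_cast
  ring

/-- The summand of the terminating very-well-poised `₅F₄` series. -/
noncomputable def wellPoisedTerm (a b c : ℝ) (N k : ℕ) : ℝ :=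
  (-1) ^ k * (a + 2 * k) * poch b k * poch c k /
    (k.factorial * (N - k).factorial * poch (a + k) (N + 1) *
      poch (1 + a - b) k * poch (1 + a - c) k)

/-- The partial sums of the creative telescoping recurrence for `wellPoisedTerm`. -/
lemma sum_wellPoisedTerm_recurrence {a b c : ℝ} (ha : 0 < a) (hb : 0 < 1 + a - b)
    (hc : 0 < 1 + a - c) {N n : ℕ} (hn : n ≤ N + 1) :
    ∑ k ∈ Finset.range n,
      ((N + 1) * (1 + a - b + N) * (1 + a - c + N) * wellPoisedTerm a b c (N + 1) k -
        (1 + a - b - c + N) * wellPoisedTerm a b c N k) =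
    -((-1) ^ n * n * (n + a - b) * (n + a - c) * poch b n * poch c n /
      (n.factorial * (N + 1 - n).factorial * poch (a + n) (N + 1) *
        poch (1 + a - b) n * poch (1 + a - c) n)) := by
  induction n with
  | zero => simp
  | succ n ih =>
    rw [Finset.sum_range_succ, ih (by omega)]
    obtain ⟨d, rfl⟩ : ∃ d, N = n + d := ⟨N - n, by omega⟩
    have e1 : n + d + 1 - n = d + 1 := by omega
    have e2 : n + d - n = d := by omega
    have e3 : n + d + 1 - (n + 1) = d := by omega
    unfold wellPoisedTerm
    rw [e1, e2, e3]
    have p1 : poch (a + n) (n + d + 1 + 1) =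
        (a + n) * poch (a + n + 1) (n + d) * (a + n + (n + d + 1 : ℕ)) := by
      rw [poch_succ, poch_succ']
    have p2 : poch (a + n) (n + d + 1) = (a + n) * poch (a + n + 1) (n + d) := poch_succ' _ _
    have p3 : poch (a + (n + 1 : ℕ)) (n + d + 1) =
        poch (a + n + 1) (n + d) * (a + n + (n + d + 1 : ℕ)) := by
      rw [poch_succ]
      push_cast
      ring_nf
    rw [p1, p2, p3]
    simp only [poch_succ, Nat.factorial_succ, pow_succ]
    have q1 := poch_pos (a := a + n + 1) (by positivity) (n + d)
    have q2 := poch_pos hb n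
    have q3 := poch_pos hc n
    have q4 : 0 < 1 + a - b + n := by positivity
    have q5 : 0 < 1 + a - c + n := by positivity
    have f1 : (0 : ℝ) < n.factorial := by positivity
    have f2 : (0 : ℝ) < d.factorial := by positivity
    have q6 : 0 < a + n := by positivity
    have q7 : 0 < a + n + (n + d + 1) := by positivity
    generalize poch (a + n + 1) (n + d) = P at *
    generalize poch (1 + a - b) n = Q at *
    generalize poch (1 + a - c) n = R at *
    generalize poch b n = U at *
    generalize poch c n = V at *
    push_cast
    generalize ((n.factorial : ℕ) : ℝ) = F at *
    generalize ((d.factorial : ℕ) : ℝ) = G at *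
    generalize ((-1 : ℝ)) ^ n = S at *
    have hn0 : (0 : ℝ) ≤ n := by positivity
    have hd0 : (0 : ℝ) ≤ d := by positivity
    generalize (n : ℝ) = n' at *
    generalize (d : ℝ) = d' at *
    have q8 : 0 < d' + 1 := by positivity
    have q9 : 0 < n' + 1 := by positivity
    field_simp
    ring

lemma sum_wellPoisedTerm {a b c : ℝ} (ha : 0 < a) (hb : 0 < 1 + a - b)
    (hc : 0 < 1 + a - c) (N : ℕ) :
    ∑ k ∈ Finset.range (N + 1), wellPoisedTerm a b c N k =
      poch (1 + a - b - c) N /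
        (N.factorial * poch (1 + a - b) N * poch (1 + a - c) N) := by
  induction N with
  | zero => simp [wellPoisedTerm, poch_zero, poch_succ, ha.ne']
  | succ N ih =>
    have h := sum_wellPoisedTerm_recurrence ha hb hc (le_refl (N + 1))
    rw [Finset.sum_sub_distrib, ← Finset.mul_sum, ← Finset.mul_sum, ih] at h
    have q2 := poch_pos hb N
    have q3 := poch_pos hc N
    have q4 : 0 < 1 + a - b + N := by positivity
    have q5 : 0 < 1 + a - c + N := by positivity
    have hX : (0 : ℝ) < (N + 1) * (1 + a - b + N) * (1 + a - c + N) := by positivity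
    have htop : (N + 1) * (1 + a - b + N) * (1 + a - c + N) *
          wellPoisedTerm a b c (N + 1) (N + 1) =
        (-1) ^ (N + 1) * ((N + 1 : ℕ) : ℝ) * ((N + 1 : ℕ) + a - b) * ((N + 1 : ℕ) + a - c) *
          poch b (N + 1) * poch c (N + 1) /
        ((N + 1).factorial * (N + 1 - (N + 1)).factorial * poch (a + (N + 1 : ℕ)) (N + 1) *
          poch (1 + a - b) (N + 1) * poch (1 + a - c) (N + 1)) := by
      unfold wellPoisedTerm
      rw [poch_succ (a + (N + 1 : ℕ)) (N + 1)]
      have q1 := poch_pos (a := a + (N + 1 : ℕ)) (by positivity) (N + 1)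
      have q6 := poch_pos hb (N + 1)
      have q7 := poch_pos hc (N + 1)
      have q8 : 0 < a + ((N + 1 : ℕ) : ℝ) + (N + 1 : ℕ) := by positivity
      field_simp
      push_cast
      ring
    have hstep : (N + 1) * (1 + a - b + N) * (1 + a - c + N) *
          ∑ k ∈ Finset.range (N + 1 + 1), wellPoisedTerm a b c (N + 1) k =
        (1 + a - b - c + N) * (poch (1 + a - b - c) N /
          (N.factorial * poch (1 + a - b) N * poch (1 + a - c) N)) := by
      rw [Finset.sum_range_succ, mul_add, htop]
      linear_combination h
    apply mul_left_cancel₀ hX.ne'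
    rw [hstep, poch_succ, poch_succ, poch_succ, Nat.factorial_succ]
    push_cast
    field_simp

/-- The coefficients of the product `P_{i-j}^{(-α-i-3,-β-i-3)} P_j^{(α+2,β+2)}` in terms of
`wellPoisedTerm`, where `i = m + s + N`, `j = m + k`. -/
lemma coeff_eq_wellPoisedTerm (α σ : ℝ) (hσ : 0 < σ) (m s N k : ℕ) (hk : k ≤ N) :
    (σ + 2 * (m + k : ℕ)) / poch (σ + (m + k : ℕ)) (m + s + N + 1) *
        (poch (σ - 1) (m + k + 1) * poch (σ - 1) (m + k) /
          ((m + k + 1).factorial * (m + k).factorial)) *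
        (poch (-(σ + (m + s + N : ℕ) + (m + k : ℕ))) s / s.factorial *
          (poch (-α - (m + s + N : ℕ) - 2 + s) (N - k) / (N - k).factorial)) *
        (poch (σ + (m + k : ℕ)) m / m.factorial * (poch (α + 3 + m) k / k.factorial)) =
      (-1) ^ (s + N) * poch (α + 3 + m) N *
        (poch (σ - 1) (m + 1) * poch (σ - 1) m / ((m + 1).factorial * m.factorial)) /
          (s.factorial * m.factorial) *
        wellPoisedTerm (σ + 2 * m) (σ + m) (σ - 1 + m) N k := by
  obtain ⟨n, rfl⟩ := Nat.exists_eq_add_of_le hk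
  have e1 : k + n - k = n := by omega
  unfold wellPoisedTerm
  rw [e1]
  have h1 : poch (-(σ + (m + s + (k + n) : ℕ) + (m + k : ℕ))) s =
      (-1) ^ s * poch (σ + (m + k : ℕ) + (m + (k + n + 1) : ℕ)) s := by
    rw [← poch_neg]
    congr 1
    push_cast
    ring
  have h2 : poch (-α - (m + s + (k + n) : ℕ) - 2 + s) n =
      (-1) ^ n * poch (α + 3 + m + k) n := by
    rw [← poch_neg]
    congr 1
    push_cast
    ring
  have h3 : poch (σ + (m + k : ℕ)) (m + s + (k + n) + 1) =
      poch (σ + (m + k : ℕ)) m * poch (σ + 2 * m + k) (k + n + 1) *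
        poch (σ + (m + k : ℕ) + (m + (k + n + 1) : ℕ)) s := by
    have e2 : m + s + (k + n) + 1 = m + (k + n + 1) + s := by omega
    rw [e2, poch_add, poch_add _ m]
    congr 3
    push_cast
    ring
  have h4 : poch (α + 3 + m) (k + n) = poch (α + 3 + m) k * poch (α + 3 + m + k) n :=
    poch_add _ _ _
  have h5 : poch (σ - 1) (m + k + 1) = poch (σ - 1) (m + 1) * poch (σ + m) k := by
    have e2 : m + k + 1 = m + 1 + k := by omega
    rw [e2, poch_add]
    congr 2
    push_cast
    ring
  have h6 : poch (σ - 1) (m + k) = poch (σ - 1) m * poch (σ - 1 + m) k := poch_add _ _ _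
  have h7 : ((m + k).factorial : ℝ) = m.factorial * poch (1 + (σ + 2 * m) - (σ + m)) k := by
    rw [← factorial_mul_poch]
    congr 2
    ring
  have h8 : ((m + k + 1).factorial : ℝ) =
      (m + 1).factorial * poch (1 + (σ + 2 * m) - (σ - 1 + m)) k := by
    have e2 : m + k + 1 = m + 1 + k := by omega
    rw [e2, ← factorial_mul_poch]
    congr 2
    push_cast
    ring
  rw [h1, h2, h3, h4, h5, h6, h7, h8]
  have q1 := poch_pos (a := σ + (m + k : ℕ)) (by positivity) m
  have q2 := poch_pos (a := σ + 2 * m + k) (by positivity) (k + n + 1)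
  have q3 := poch_pos (a := σ + (m + k : ℕ) + (m + (k + n + 1) : ℕ)) (by positivity) s
  have q4 : 0 < poch (1 + (σ + 2 * m) - (σ + m)) k :=
    poch_pos (by ring_nf; positivity) k
  have q5 : 0 < poch (1 + (σ + 2 * m) - (σ - 1 + m)) k :=
    poch_pos (by ring_nf; positivity) k
  have hs : ((-1 : ℝ)) ^ (s + (k + n)) * (-1) ^ k = (-1) ^ s * (-1) ^ n := by
    rw [← pow_add, ← pow_add, show s + (k + n) + k = s + n + 2 * k by ring, pow_add _ _ (2 * k),
      pow_mul]
    simp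
  have f1 : (0 : ℝ) < (m + 1).factorial := by positivity
  generalize ((m + 1).factorial : ℝ) = M1 at *
  have hc : σ + 2 * ((m + k : ℕ) : ℝ) = σ + 2 * m + 2 * k := by push_cast; ring
  rw [hc]
  generalize poch (σ + (m + k : ℕ)) m = P1 at *
  generalize poch (σ + 2 * m + k) (k + n + 1) = P2 at *
  generalize poch (σ + (m + k : ℕ) + (m + (k + n + 1) : ℕ)) s = P3 at *
  generalize poch (1 + (σ + 2 * m) - (σ + m)) k = P4 at *
  generalize poch (1 + (σ + 2 * m) - (σ - 1 + m)) k = P5 at *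
  generalize (-1 : ℝ) ^ (s + (k + n)) = S1 at *
  generalize (-1 : ℝ) ^ k = S2 at *
  generalize (-1 : ℝ) ^ s = S3 at *
  generalize (-1 : ℝ) ^ n = S4 at *
  field_simp
  linear_combination (-(poch (σ - 1) (m + 1) * poch (σ + m) k * poch (σ - 1) m *
    poch (σ - 1 + m) k * poch (α + 3 + m + k) n * poch (α + 3 + m) k)) * hs

/-- The closed form of the inner sum obtained by summing `wellPoisedTerm`. -/
lemma wellPoised_closed_form (α σ : ℝ) (hα : 0 < α + 3) (m s N : ℕ) :
    (-1) ^ (s + N) * poch (α + 3 + m) N *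
        (poch (σ - 1) (m + 1) * poch (σ - 1) m / ((m + 1).factorial * m.factorial)) /
          (s.factorial * m.factorial) *
        (poch (2 - σ) N / (N.factorial * poch ((m : ℝ) + 1) N * poch ((m : ℝ) + 2) N)) =
      (σ - 1) * (-1) ^ (m + s + N) *
        (poch (α + 3) N * poch (2 - σ) N /
          ((N + 1).factorial * N.factorial * (s + m).factorial * N.factorial)) *
        (poch (-((s + m : ℕ) : ℝ)) m * poch σ m * poch (σ - 1) m * poch (α + 3 + N) m /
          (poch (α + 3) m * poch ((N : ℝ) + 2) m * poch ((N : ℝ) + 1) m * m.factorial)) := by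
  have h1 : poch (α + 3) m * poch (α + 3 + m) N = poch (α + 3) N * poch (α + 3 + N) m := by
    rw [← poch_add, ← poch_add, Nat.add_comm]
  have h2 : poch (σ - 1) (m + 1) = (σ - 1) * poch σ m := by
    rw [poch_succ']
    congr 2
    ring
  have h3 : (m.factorial : ℝ) * poch ((m : ℝ) + 1) N = N.factorial * poch ((N : ℝ) + 1) m := by
    rw [factorial_mul_poch, factorial_mul_poch, add_comm]
  have h4 : ((m + 1).factorial : ℝ) * poch ((m : ℝ) + 2) N =
      (N + 1).factorial * poch ((N : ℝ) + 2) m := by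
    have e (p : ℕ) : (p : ℝ) + 2 = ((p + 1 : ℕ) : ℝ) + 1 := by push_cast; ring
    rw [e, e, factorial_mul_poch, factorial_mul_poch]
    congr 2
    omega
  have h5 := factorial_mul_poch_neg s m
  have hs : ((-1 : ℝ)) ^ (m + s + N) * (-1) ^ m = (-1) ^ (s + N) := by
    rw [← pow_add, show m + s + N + m = s + N + 2 * m by ring, pow_add _ _ (2 * m), pow_mul]
    simp
  have q1 := poch_pos (a := (m : ℝ) + 1) (by positivity) N
  have q2 := poch_pos (a := (m : ℝ) + 2) (by positivity) N
  have q3 := poch_pos (a := (N : ℝ) + 1) (by positivity) m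
  have q4 := poch_pos (a := (N : ℝ) + 2) (by positivity) m
  have q5 := poch_pos hα m
  have f1 : (0 : ℝ) < (m + 1).factorial := by positivity
  have f2 : (0 : ℝ) < (N + 1).factorial := by positivity
  have f3 : (0 : ℝ) < (s + m).factorial := by positivity
  have f4 : (0 : ℝ) < s.factorial := by positivity
  have h5' : poch (-((s + m : ℕ) : ℝ)) m = (-1) ^ m * (s + m).factorial / s.factorial := by
    rw [eq_div_iff f4.ne', ← h5, mul_comm]
  have h1' : poch (α + 3 + m) N = poch (α + 3) N * poch (α + 3 + N) m / poch (α + 3) m := by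
    rw [eq_div_iff q5.ne', ← h1, mul_comm]
  have h3' : poch ((m : ℝ) + 1) N = N.factorial * poch ((N : ℝ) + 1) m / m.factorial := by
    rw [eq_div_iff (by positivity), ← h3, mul_comm]
  have h4' : poch ((m : ℝ) + 2) N =
      (N + 1).factorial * poch ((N : ℝ) + 2) m / (m + 1).factorial := by
    rw [eq_div_iff (by positivity), ← h4, mul_comm]
  rw [h5', h1', h3', h4', h2, ← hs]
  generalize ((m + 1).factorial : ℝ) = M1 at *
  generalize ((N + 1).factorial : ℝ) = N1 at *
  generalize ((s + m).factorial : ℝ) = M2 at *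
  generalize (-1 : ℝ) ^ (m + s + N) = S1 at *
  generalize (-1 : ℝ) ^ m = S2 at *
  field_simp

/-- Reindexing of a triple sum through `j = m + k`, `s = ℓ - m`. -/
lemma sum_triple_reindex (i : ℕ) (f : ℕ → ℕ → ℕ → ℝ) :
    ∑ j ∈ Finset.range (i + 1), ∑ s ∈ Finset.range (i - j + 1), ∑ m ∈ Finset.range (j + 1),
        f j s m =
      ∑ ℓ ∈ Finset.range (i + 1), ∑ m ∈ Finset.range (ℓ + 1), ∑ k ∈ Finset.range (i - ℓ + 1),
        f (m + k) (ℓ - m) m := by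
  simp only [Finset.sum_sigma']
  refine Finset.sum_bij' (fun p _ => ⟨p.2.1 + p.2.2, p.2.2, p.1 - p.2.2⟩)
    (fun p _ => ⟨p.2.1 + p.2.2, p.1 - p.2.1, p.2.1⟩) ?_ ?_ ?_ ?_ ?_
  · rintro ⟨j, s, m⟩ h
    simp only [Finset.mem_sigma, Finset.mem_range] at h ⊢
    omega
  · rintro ⟨l, m, k⟩ h
    simp only [Finset.mem_sigma, Finset.mem_range] at h ⊢
    omega
  · rintro ⟨j, s, m⟩ h
    simp only [Finset.mem_sigma, Finset.mem_range] at h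
    have h1 : m + (j - m) = j := by omega
    simp [h1]
  · rintro ⟨l, m, k⟩ h
    simp only [Finset.mem_sigma, Finset.mem_range] at h
    have h1 : l - m + m = l := by omega
    simp [h1]
  · rintro ⟨j, s, m⟩ h
    simp only [Finset.mem_sigma, Finset.mem_range] at h
    have h1 : m + (j - m) = j := by omega
    simp [h1]

/-- the key sum identity used to compute the coefficients `C_i(x)`. -/
theorem sum_identity_C (α β : ℝ) (hα : -1 < α) (hβ : -1 < β) (i : ℕ) (x : ℝ) :
    ∑ j ∈ Finset.range (i + 1),
      (α + β + 2 * j + 5) / poch (α + β + (j : ℝ) + 5) (i + 1) *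
        (poch (α + β + 4) (j + 1) * poch (α + β + 4) j /
          (Nat.factorial (j + 1) * Nat.factorial j)) *
        jacobiP (-α - (i : ℝ) - 3) (-β - (i : ℝ) - 3) (i - j) x *
        jacobiP (α + 2) (β + 2) j x
    = (α + β + 4) * (-1 : ℝ) ^ i *
        ∑ ℓ ∈ Finset.range (i + 1),
          poch (α + 3) (i - ℓ) * poch (-α - β - 3) (i - ℓ) /
            (Nat.factorial (i - ℓ + 1) * Nat.factorial (i - ℓ) * Nat.factorial ℓ *
              Nat.factorial (i - ℓ)) *
          (∑ m ∈ Finset.range (ℓ + 1),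
            poch (-(ℓ : ℝ)) m * poch (α + β + 5) m * poch (α + β + 4) m *
              poch (α + (i : ℝ) - (ℓ : ℝ) + 3) m /
              (poch (α + 3) m * poch ((i : ℝ) - (ℓ : ℝ) + 2) m *
                poch ((i : ℝ) - (ℓ : ℝ) + 1) m * Nat.factorial m)) *
          ((x - 1) / 2) ^ ℓ := by
  have hprod (a b : ℝ) (u v : ℕ → ℝ) (p q : ℕ) :
      a * b * (∑ s ∈ Finset.range p, u s) * (∑ m ∈ Finset.range q, v m) =
        ∑ s ∈ Finset.range p, ∑ m ∈ Finset.range q, a * b * u s * v m := by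
    rw [mul_assoc, Finset.sum_mul_sum, Finset.mul_sum]
    refine Finset.sum_congr rfl fun s _ => ?_
    rw [Finset.mul_sum]
    exact Finset.sum_congr rfl fun m _ => by ring
  simp only [jacobiP, hprod]
  rw [sum_triple_reindex i (fun j s m => _), Finset.mul_sum]
  refine Finset.sum_congr rfl fun ℓ hℓ => ?_
  rw [Finset.mul_sum, Finset.sum_mul, Finset.mul_sum]
  refine Finset.sum_congr rfl fun m hm => ?_
  rw [Finset.mem_range] at hℓ hm
  obtain ⟨s, rfl⟩ : ∃ s, ℓ = s + m := ⟨ℓ - m, by omega⟩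
  obtain ⟨N, rfl⟩ : ∃ N, i = m + s + N := ⟨i - (s + m), by omega⟩
  have e1 : m + s + N - (s + m) = N := by omega
  have e2 : s + m - m = s := by omega
  rw [e1, e2]
  obtain ⟨σ, hσ⟩ : ∃ σ, σ = α + β + 5 := ⟨_, rfl⟩
  have hσ3 : 0 < σ := by linarith
  have key : ∑ k ∈ Finset.range (N + 1), (-1) ^ (s + N) * poch (α + 3 + m) N *
        (poch (σ - 1) (m + 1) * poch (σ - 1) m / ((m + 1).factorial * m.factorial)) /
          (s.factorial * m.factorial) *
        wellPoisedTerm (σ + 2 * m) (σ + m) (σ - 1 + m) N k * ((x - 1) / 2) ^ (s + m) =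
      (σ - 1) * (-1) ^ (m + s + N) *
        (poch (α + 3) N * poch (2 - σ) N /
          ((N + 1).factorial * N.factorial * (s + m).factorial * N.factorial)) *
        (poch (-((s + m : ℕ) : ℝ)) m * poch σ m * poch (σ - 1) m * poch (α + 3 + N) m /
          (poch (α + 3) m * poch ((N : ℝ) + 2) m * poch ((N : ℝ) + 1) m * m.factorial)) *
        ((x - 1) / 2) ^ (s + m) := by
    rw [← Finset.sum_mul, ← Finset.mul_sum, sum_wellPoisedTerm (by positivity)
      (by ring_nf; positivity) (by ring_nf; positivity),
      show 1 + (σ + 2 * (m : ℝ)) - (σ + m) - (σ - 1 + m) = 2 - σ by ring,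
      show 1 + (σ + 2 * (m : ℝ)) - (σ + m) = m + 1 by ring,
      show 1 + (σ + 2 * (m : ℝ)) - (σ - 1 + m) = m + 2 by ring,
      wellPoised_closed_form α σ (by linarith)]
  refine (Finset.sum_congr rfl fun k hk => ?_).trans (key.trans ?_)
  · rw [Finset.mem_range] at hk
    rw [← coeff_eq_wellPoisedTerm α σ hσ3 m s N k (by omega)]
    have e3 : m + s + N - (m + k) - s = N - k := by omega
    have e4 : m + k - m = k := by omega
    have e5 : ((m + s + N - (m + k) : ℕ) : ℝ) = (m + s + N : ℕ) - (m + k : ℕ) :=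
      Nat.cast_sub (by omega)
    rw [e3, e4, e5]
    have a1 : α + β + ((m + k : ℕ) : ℝ) + 5 = σ + (m + k : ℕ) := by rw [hσ]; ring
    have a2 : α + β + 2 * ((m + k : ℕ) : ℝ) + 5 = σ + 2 * (m + k : ℕ) := by rw [hσ]; ring
    have a3 : α + β + 4 = σ - 1 := by rw [hσ]; ring
    have a4 : ((m + s + N : ℕ) : ℝ) - (m + k : ℕ) + (-α - (m + s + N : ℕ) - 3) +
        (-β - (m + s + N : ℕ) - 3) + 1 = -(σ + (m + s + N : ℕ) + (m + k : ℕ)) := by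
      rw [hσ]; ring
    have a5 : -α - ((m + s + N : ℕ) : ℝ) - 3 + s + 1 = -α - (m + s + N : ℕ) - 2 + s := by ring
    have a6 : ((m + k : ℕ) : ℝ) + (α + 2) + (β + 2) + 1 = σ + (m + k : ℕ) := by rw [hσ]; ring
    have a7 : α + 2 + (m : ℝ) + 1 = α + 3 + m := by ring
    rw [a1, a2, a3, a4, a5, a6, a7, pow_add]
    ring
  · have b1 : α + β + 4 = σ - 1 := by rw [hσ]; ring
    have b2 : -α - β - 3 = 2 - σ := by rw [hσ]; ring
    have b3 : ((m + s + N : ℕ) : ℝ) - (s + m : ℕ) = N := by push_cast; ring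
    have b4 : α + ((m + s + N : ℕ) : ℝ) - (s + m : ℕ) + 3 = α + 3 + N := by push_cast; ring
    rw [b1, b2, b3, b4, ← hσ]
    ring
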